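/- arXiv:2102.12977 — 2 statements merged into one kernel-verified Lean document; each statement's English description precedes it below -/
import Mathlib

section
/- Every rational solution (x, y) ∈ ℚ × ℚ of the equation y² = x(x + 482)(x − 241) satisfies y = 0; equivalently, the Mordell–Weil group over ℚ of the elliptic curve E₂ : y² = x(x + 482)(x − 241) is isomorphic to ℤ/2ℤ × ℤ/2ℤ. -/
namespace RationalPointsE2

lemma exists_gcd_factorization (a b : ℤ) (h : b ≠ 0) :
    ∃ g a' b' : ℤ, g ≠ 0 ∧ b' ≠ 0 ∧ IsCoprime a' b' ∧ a = g * a' ∧ b = g * b' := by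
  obtain ⟨a', b', hc, ha, hb⟩ := Int.exists_gcd_one (Int.gcd_pos_of_ne_zero_right a h)
  refine ⟨Int.gcd a b, a', b', ?_, ?_, Int.isCoprime_iff_gcd_eq_one.2 hc,
    by rwa [mul_comm], by rwa [mul_comm]⟩
  · exact right_ne_zero_of_mul (hb ▸ h)
  · exact left_ne_zero_of_mul (hb ▸ h)

lemma dvd_of_sq_dvd_squarefree_mul_sq {k g z : ℤ} (hk : Squarefree k)
    (h : g ^ 2 ∣ k * z ^ 2) : g ∣ z := by
  rcases eq_or_ne g 0 with rfl | hg
  · have h0 : k * z ^ 2 = 0 := by simpa using h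
    have hz : z = 0 := by simpa [hk.ne_zero] using h0
    simp [hz]
  obtain ⟨d, z', g', hd, -, hcop, rfl, rfl⟩ := exists_gcd_factorization z g hg
  have h' : g' ^ 2 ∣ k * z' ^ 2 := by
    refine Int.dvd_of_mul_dvd_mul_left (pow_ne_zero 2 hd) (a := d ^ 2) ?_
    convert h using 1 <;> ring
  have hu : g' ^ 2 ∣ k := (hcop.symm.pow (m := 2) (n := 2)).dvd_of_dvd_mul_right h'
  exact mul_dvd_mul_left d (hk g' (sq g' ▸ hu)).dvd

/-- A factor of `k` times a square, coprime to its cofactor, is a square up to a divisor of `k`. -/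
lemma exists_eq_dvd_mul_sq {k n m t : ℤ} (hk : k ≠ 0) (hnm : IsCoprime n m)
    (h : n * m = k * t ^ 2) : ∃ g s : ℤ, g ∣ k ∧ n = g * s ^ 2 := by
  obtain ⟨g, n', k', hg, -, hc, rfl, rfl⟩ := exists_gcd_factorization n k hk
  have h1 : n' * m = k' * t ^ 2 := mul_left_cancel₀ hg (by linear_combination h)
  obtain ⟨m', rfl⟩ : k' ∣ m := hc.symm.dvd_of_dvd_mul_left ⟨_, h1⟩
  have hk' : k' ≠ 0 := right_ne_zero_of_mul hk
  have h2 : n' * m' = t ^ 2 := mul_left_cancel₀ hk' (by linear_combination h1)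
  obtain ⟨s, rfl | rfl⟩ :=
    Int.sq_of_isCoprime (hnm.of_mul_left_right.of_mul_right_right) h2
  · exact ⟨g, s, dvd_mul_right _ _, rfl⟩
  · exact ⟨-g, s, (neg_dvd.2 (dvd_mul_right _ _)), by ring⟩

lemma isCoprime_of_forall_dvd {m n x y : ℤ} (hxy : IsCoprime x y)
    (h : ∀ g : ℤ, g ∣ m → g ∣ n → g ∣ x ∧ g ∣ y) : IsCoprime m n :=
  isRelPrime_iff_isCoprime.1 fun g hm hn ↦
    hxy.isRelPrime (h g hm hn).1 (h g hm hn).2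

lemma squarefree_two : Squarefree (2 : ℤ) := Int.prime_two.squarefree

lemma squarefree_three : Squarefree (3 : ℤ) := Int.prime_three.squarefree

lemma prime_241 : Prime (241 : ℤ) := by
  rw [Int.prime_iff_natAbs_prime]; norm_num

instance fact_prime_241 : Fact (Nat.Prime 241) := ⟨by norm_num⟩

lemma isSquare_two : IsSquare (2 : ZMod 241) := ⟨22, by decide⟩

lemma isSquare_neg_one : IsSquare (-1 : ZMod 241) := ⟨64, by decide⟩

lemma isSquare_of_dvd_six {g : ℤ} (hg : g ∣ 6) : IsSquare (g : ZMod 241) := by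
  have h3 : IsSquare (3 : ZMod 241) := ⟨56, by decide⟩
  have h6 : IsSquare (6 : ZMod 241) := by
    simpa [show (2 * 3 : ZMod 241) = 6 by decide] using isSquare_two.mul h3
  have hn : ∀ {x : ZMod 241}, IsSquare x → IsSquare (-x) := fun hx ↦ by
    simpa using isSquare_neg_one.mul hx
  have h1 : g ≤ 6 := Int.le_of_dvd (by norm_num) hg
  have h2 : -g ≤ 6 := Int.le_of_dvd (by norm_num) (neg_dvd.2 hg)
  have h2' : -6 ≤ g := by linarith
  clear h2
  interval_cases g <;>
    first
    | exact absurd hg (by decide)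
    | (push_cast
       first
       | exact hn h6 | exact hn h3 | exact hn isSquare_two | exact hn .one
       | exact h6 | exact h3 | exact isSquare_two | exact .one)

/-- By quadratic reciprocity, a number modulo which `241` is a square is a square modulo `241`. -/
lemma isSquare_of_dvd_sq_sub {t y z : ℤ} (hc : IsCoprime t z) (h : t ∣ y ^ 2 - 241 * z ^ 2) :
    IsSquare (t : ZMod 241) := by
  have key : ∀ n : ℕ, (n : ℤ) ∣ y ^ 2 - 241 * z ^ 2 → IsCoprime (n : ℤ) z →
      IsSquare (n : ZMod 241) := by
    intro n
    induction n using Nat.recOnMul with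
    | zero => intro _ _; exact ⟨0, by simp⟩
    | one => intro _ _; exact ⟨1, by simp⟩
    | mul a b iha ihb =>
      intro hd hcop
      push_cast at hd hcop ⊢
      exact (iha ((dvd_mul_right _ _).trans hd) hcop.of_mul_left_left).mul
        (ihb ((dvd_mul_left _ _).trans hd) hcop.of_mul_left_right)
    | prime q hq =>
      intro hd hcop
      have : Fact q.Prime := ⟨hq⟩
      rcases eq_or_ne q 2 with rfl | hq2
      · exact isSquare_two
      refine (ZMod.exists_sq_eq_prime_iff_of_mod_four_eq_one (p := 241) (by norm_num) hq2).2 ?_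
      have hz : (z : ZMod q) ≠ 0 := fun h0 ↦
        (Nat.prime_iff_prime_int.1 hq).not_isUnit
          (hcop.isUnit_of_dvd' dvd_rfl ((ZMod.intCast_zmod_eq_zero_iff_dvd z q).1 h0))
      have h0 := (ZMod.intCast_zmod_eq_zero_iff_dvd _ q).2 hd
      push_cast at h0 ⊢
      refine ⟨y / z, ?_⟩
      field_simp
      linear_combination -h0
  obtain ⟨n, rfl | rfl⟩ := t.eq_nat_or_neg
  · simpa using key n h hc
  · simpa using isSquare_neg_one.mul (key n (neg_dvd.1 h) ((IsCoprime.neg_left_iff _ _).1 hc))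

lemma isSquare_add {k x y t : ℤ} (hk : Squarefree k) (hk6 : k ∣ 6) (hc : IsCoprime x y)
    (h : x ^ 2 = y ^ 2 + k * t ^ 2) : IsSquare ((x + y : ℤ) : ZMod 241) := by
  have hfac : (x + y) * (x - y) = k * t ^ 2 := by linear_combination h
  have h2 : ∀ g : ℤ, g ∣ k → IsSquare (g : ZMod 241) := fun g hg ↦
    isSquare_of_dvd_six (hg.trans hk6)
  rcases Int.even_or_odd' (x + y) with ⟨n, hn | hn⟩
  · have hm : x - y = 2 * (n - y) := by linarith
    obtain ⟨s, rfl⟩ : (2 : ℤ) ∣ t := by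
      refine dvd_of_sq_dvd_squarefree_mul_sq hk ⟨n * (n - y), ?_⟩
      rw [← hfac, hn, hm]; ring
    have hnm : IsCoprime n (n - y) := isCoprime_of_forall_dvd hc fun g h1 h2 ↦ by
      have hy : g ∣ y := by simpa using dvd_sub h1 h2
      refine ⟨?_, hy⟩
      rw [show x = n + (n - y) by linarith]
      exact dvd_add h1 h2
    obtain ⟨g, r, hg, hr⟩ := exists_eq_dvd_mul_sq hk.ne_zero hnm (t := s) (by
      rw [hn, hm] at hfac; linarith)
    rw [hn, hr]
    push_cast
    exact isSquare_two.mul ((h2 g hg).mul (.sq _))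
  · have hnm : IsCoprime (x + y) (x - y) := by
      refine isCoprime_of_forall_dvd hc fun g h1 h2 ↦ ?_
      have hg2 : IsCoprime g 2 := by
        obtain ⟨w, hw⟩ := h1
        have hgo : Odd (g * w) := hw ▸ ⟨n, hn⟩
        exact Int.isCoprime_two_right.2 (Int.odd_mul.1 hgo).1
      constructor
      · refine hg2.dvd_of_dvd_mul_left ?_
        convert dvd_add h1 h2 using 1; ring
      · refine hg2.dvd_of_dvd_mul_left ?_
        convert dvd_sub h1 h2 using 1; ring
    obtain ⟨g, r, hg, hr⟩ := exists_eq_dvd_mul_sq hk.ne_zero hnm hfac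
    rw [hr]
    push_cast
    exact (h2 g hg).mul (.sq _)

/-- A genus one curve `x² = y² + k t²`, `241 z² = y² + l t²` has no rational points as soon as
`√(-l) + √(k - l)` is never a square modulo `241`. -/
lemma eq_zero_of_not_isSquare {k l : ℤ} (hk : Squarefree k) (hk6 : k ∣ 6)
    (hkl : ∀ a b : ZMod 241, a ^ 2 = -l → b ^ 2 = k - l → ¬ IsSquare (b + a))
    {x y t z : ℤ} (h1 : x ^ 2 = y ^ 2 + k * t ^ 2) (h2 : 241 * z ^ 2 = y ^ 2 + l * t ^ 2) :
    z = 0 := by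
  rcases eq_or_ne t 0 with rfl | ht
  · obtain ⟨w, hw⟩ := dvd_of_sq_dvd_squarefree_mul_sq prime_241.squarefree (g := y) (z := z)
      ⟨1, by linear_combination h2⟩
    subst hw
    by_contra hz
    have hy : y ^ 2 ≠ 0 := pow_ne_zero 2 (left_ne_zero_of_mul hz)
    have : 241 * w ^ 2 = 1 := mul_left_cancel₀ hy (by linear_combination h2)
    omega
  obtain ⟨g, y', t', hg, -, hc, rfl, rfl⟩ := exists_gcd_factorization y t ht
  obtain ⟨x', rfl⟩ : g ∣ x := (Int.pow_dvd_pow_iff two_ne_zero).1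
    ⟨y' ^ 2 + k * t' ^ 2, by rw [h1]; ring⟩
  obtain ⟨z', rfl⟩ : g ∣ z := dvd_of_sq_dvd_squarefree_mul_sq prime_241.squarefree
    ⟨y' ^ 2 + l * t' ^ 2, by rw [h2]; ring⟩
  have hg2 : g ^ 2 ≠ 0 := pow_ne_zero 2 hg
  replace h1 : x' ^ 2 = y' ^ 2 + k * t' ^ 2 := mul_left_cancel₀ hg2 (by linear_combination h1)
  replace h2 : 241 * z' ^ 2 = y' ^ 2 + l * t' ^ 2 :=
    mul_left_cancel₀ hg2 (by linear_combination h2)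
  exfalso
  have hxy : IsCoprime x' y' := isCoprime_of_forall_dvd hc fun d hx hy ↦ by
    refine ⟨hy, dvd_of_sq_dvd_squarefree_mul_sq hk ?_⟩
    rw [show k * t' ^ 2 = x' ^ 2 - y' ^ 2 by linarith]
    exact dvd_sub (pow_dvd_pow_of_dvd hx 2) (pow_dvd_pow_of_dvd hy 2)
  have htz : IsCoprime t' z' := isCoprime_of_forall_dvd hc fun d ht hz ↦ by
    refine ⟨(Int.pow_dvd_pow_iff two_ne_zero).1 ?_, ht⟩
    rw [show y' ^ 2 = 241 * z' ^ 2 - l * t' ^ 2 by linarith]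
    exact dvd_sub ((pow_dvd_pow_of_dvd hz 2).mul_left _) ((pow_dvd_pow_of_dvd ht 2).mul_left _)
  have hst : IsSquare (t' : ZMod 241) :=
    isSquare_of_dvd_sq_sub (y := y') htz ⟨-(l * t'), by rw [h2]; ring⟩
  have hs := isSquare_add hk hk6 hxy h1
  have ht0 : (t' : ZMod 241) ≠ 0 := fun h0 ↦ by
    have h241 := (ZMod.intCast_zmod_eq_zero_iff_dvd t' 241).1 h0
    refine prime_241.not_isUnit (hc.isUnit_of_dvd' (prime_241.dvd_of_dvd_pow (n := 2) ?_) h241)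
    rw [show y' ^ 2 = 241 * z' ^ 2 - l * t' ^ 2 by linarith]
    exact dvd_sub (dvd_mul_right _ _) ((dvd_pow h241 two_ne_zero).mul_left _)
  have e1 := congrArg (Int.cast : ℤ → ZMod 241) h1
  have e2 := congrArg (Int.cast : ℤ → ZMod 241) h2
  have e3 : (241 : ZMod 241) = 0 := by decide
  push_cast at e1 e2 hs
  rw [e3] at e2
  refine hkl (y' / t') (x' / t') ?_ ?_ ?_
  · field_simp; linear_combination -e2
  · field_simp; linear_combination e1 - e2
  · rw [← add_div]; exact hs.div hst

lemma not_isSquare_add {a b : ZMod 241} (c d : ZMod 241) (ha : a ^ 2 = c ^ 2) (hb : b ^ 2 = d ^ 2)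
    (h : ¬ IsSquare (d + c)) (h' : ¬ IsSquare (d - c)) : ¬ IsSquare (b + a) := by
  have hn : ∀ {x : ZMod 241}, IsSquare (-x) → IsSquare x := fun hx ↦ by
    simpa using isSquare_neg_one.mul hx
  rcases sq_eq_sq_iff_eq_or_eq_neg.1 ha with rfl | rfl <;>
    rcases sq_eq_sq_iff_eq_or_eq_neg.1 hb with rfl | rfl <;> intro hs
  · exact h hs
  · exact h' (hn (by convert hs using 1; ring))
  · exact h' (by convert hs using 1; ring)
  · exact h (hn (by convert hs using 1; ring))

/-- Modulo `3`, the two quadrics force `u = z = 0`. -/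
lemma eq_zero_of_mod_three {k l m : ℤ} (hl : Squarefree l)
    (hmod : ∀ u v w z : ZMod 3, k * u ^ 2 + 2 * z ^ 2 = l * v ^ 2 → k * u ^ 2 - z ^ 2 = m * w ^ 2 →
      u = 0 ∧ z = 0) (hm : Squarefree m)
    {u v w z : ℤ} (h1 : k * u ^ 2 + 482 * z ^ 2 = l * v ^ 2)
    (h2 : k * u ^ 2 - 241 * z ^ 2 = m * w ^ 2) : z = 0 := by
  by_contra hz
  obtain ⟨g, u', z', hg, -, hc, rfl, rfl⟩ := exists_gcd_factorization u z hz
  obtain ⟨v', rfl⟩ : g ∣ v := dvd_of_sq_dvd_squarefree_mul_sq hl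
    ⟨k * u' ^ 2 + 482 * z' ^ 2, by rw [← h1]; ring⟩
  obtain ⟨w', rfl⟩ : g ∣ w := dvd_of_sq_dvd_squarefree_mul_sq hm
    ⟨k * u' ^ 2 - 241 * z' ^ 2, by rw [← h2]; ring⟩
  have hg2 : g ^ 2 ≠ 0 := pow_ne_zero 2 hg
  replace h1 : k * u' ^ 2 + 482 * z' ^ 2 = l * v' ^ 2 :=
    mul_left_cancel₀ hg2 (by linear_combination h1)
  replace h2 : k * u' ^ 2 - 241 * z' ^ 2 = m * w' ^ 2 :=
    mul_left_cancel₀ hg2 (by linear_combination h2)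
  have e1 := congrArg (Int.cast : ℤ → ZMod 3) h1
  have e2 := congrArg (Int.cast : ℤ → ZMod 3) h2
  have e3 : (482 : ZMod 3) = 2 := by decide
  have e4 : (241 : ZMod 3) = 1 := by decide
  push_cast at e1 e2
  rw [e3] at e1
  rw [e4, one_mul] at e2
  obtain ⟨hu, hz'⟩ := hmod _ _ _ _ e1 e2
  exact Int.prime_three.not_isUnit (hc.isUnit_of_dvd'
    ((ZMod.intCast_zmod_eq_zero_iff_dvd _ 3).1 hu) ((ZMod.intCast_zmod_eq_zero_iff_dvd _ 3).1 hz'))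

set_option maxRecDepth 4000 in
/-- Only the trivial class among the `2`-coverings met in the descent has a rational point. -/
lemma eq_one_of_covering {α ε γ : ℤ} (hα : α = 1 ∨ α = -1 ∨ α = 2 ∨ α = -2)
    (hε : ε = 1 ∨ ε = -1) (hγ : γ = 1 ∨ γ = -1 ∨ γ = 3 ∨ γ = -3) {u v w z : ℤ} (hz : z ≠ 0)
    (h1 : α * ε * u ^ 2 + 482 * z ^ 2 = α * γ * v ^ 2)
    (h2 : α * ε * u ^ 2 - 241 * z ^ 2 = ε * γ * w ^ 2) :
    α * ε = 1 ∧ α * γ = 1 ∧ ε * γ = 1 := by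
  have hz2 : 0 < z ^ 2 := by positivity
  have c1 : 241 * z ^ 2 = v ^ 2 - w ^ 2 → u ^ 2 = v ^ 2 + 2 * w ^ 2 → False := fun e1 e2 ↦
    hz (eq_zero_of_not_isSquare (k := 2) (l := -1) squarefree_two (by norm_num)
      (fun a b ha hb ↦ not_isSquare_add 1 56 (ha.trans (by decide)) (hb.trans (by decide))
        (by decide) (by decide)) e2 (by linarith))
  have c2 : 241 * z ^ 2 = v ^ 2 + u ^ 2 → w ^ 2 = v ^ 2 + 3 * u ^ 2 → False := fun e1 e2 ↦
    hz (eq_zero_of_not_isSquare (k := 3) (l := 1) squarefree_three (by norm_num)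
      (fun a b ha hb ↦ not_isSquare_add 64 22 (ha.trans (by decide)) (hb.trans (by decide))
        (by decide) (by decide)) e2 (by linarith))
  have c3 : 241 * z ^ 2 = u ^ 2 + 3 * v ^ 2 → w ^ 2 = u ^ 2 + v ^ 2 → False := fun e1 e2 ↦
    hz (eq_zero_of_not_isSquare (k := 1) (l := 3) squarefree_one (by norm_num)
      (fun a b ha hb ↦ not_isSquare_add 31 38 (ha.trans (by decide)) (hb.trans (by decide))
        (by decide) (by decide)) (by linarith) e1)
  have s1 : Squarefree (-1 : ℤ) := isUnit_one.neg.squarefree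
  have s3 : Squarefree (-3 : ℤ) := Int.prime_three.neg.squarefree
  have s6 : Squarefree (6 : ℤ) := by
    rw [show (6 : ℤ) = 2 * 3 by norm_num, squarefree_mul_iff, isRelPrime_iff_isCoprime]
    exact ⟨by norm_num, squarefree_two, squarefree_three⟩
  have m1 : 2 * u ^ 2 + 482 * z ^ 2 = 2 * v ^ 2 → 2 * u ^ 2 - 241 * z ^ 2 = 1 * w ^ 2 → False :=
    fun e1 e2 ↦ hz (eq_zero_of_mod_three squarefree_two (by decide) squarefree_one e1 e2)
  have m2 : 2 * u ^ 2 + 482 * z ^ 2 = 6 * v ^ 2 → 2 * u ^ 2 - 241 * z ^ 2 = 3 * w ^ 2 → False :=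
    fun e1 e2 ↦ hz (eq_zero_of_mod_three s6 (by decide) squarefree_three e1 e2)
  have m3 : -1 * u ^ 2 + 482 * z ^ 2 = 1 * v ^ 2 → -1 * u ^ 2 - 241 * z ^ 2 = -1 * w ^ 2 → False :=
    fun e1 e2 ↦ hz (eq_zero_of_mod_three squarefree_one (by decide) s1 e1 e2)
  have m4 : -1 * u ^ 2 + 482 * z ^ 2 = 3 * v ^ 2 → -1 * u ^ 2 - 241 * z ^ 2 = -3 * w ^ 2 → False :=
    fun e1 e2 ↦ hz (eq_zero_of_mod_three squarefree_three (by decide) s3 e1 e2)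
  have hu := sq_nonneg u
  have hv := sq_nonneg v
  have hw := sq_nonneg w
  rcases hα with rfl | rfl | rfl | rfl <;> rcases hε with rfl | rfl <;>
    rcases hγ with rfl | rfl | rfl | rfl <;> norm_num at h1 h2 ⊢ <;>
    first
    | linarith
    | exact c1 (by linarith) (by linarith)
    | exact c2 (by linarith) (by linarith)
    | exact c3 (by linarith) (by linarith)
    | exact m1 (by linarith) (by linarith)
    | exact m2 (by linarith) (by linarith)
    | exact m3 (by linarith) (by linarith)
    | exact m4 (by linarith) (by linarith)

/-- A sign of `b` can be chosen so that `b ≡ a` modulo `241`. -/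
lemma exists_sq_eq_and_dvd_sub {a b : ℤ} (h : 241 ∣ b ^ 2 - a ^ 2) :
    ∃ b' : ℤ, b' ^ 2 = b ^ 2 ∧ 241 ∣ b' - a := by
  rw [sq_sub_sq] at h
  rcases prime_241.dvd_or_dvd h with h | h
  · exact ⟨-b, neg_sq b, by rw [← dvd_neg]; convert h using 1; ring⟩
  · exact ⟨b, rfl, h⟩

/-- The halving of a point, in terms of the half sums `U`, `V`, `W` of `a`, `b`, `c`. -/
lemma exists_half_of_half_sums {U V W B C f : ℤ} (hc : IsCoprime (U + V - W) (2 * f)) (hf : f ≠ 0)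
    (hB : W - V = 241 * B) (hC : U - W = 241 * C) (e1 : U * (W - V) = 482 * f ^ 2)
    (e2 : V * (U - W) = 241 * f ^ 2) :
    ∃ a b c : ℤ, a ^ 2 + 482 * f ^ 2 = b ^ 2 ∧ a ^ 2 - 241 * f ^ 2 = c ^ 2 := by
  have e1' : U * B = 2 * f ^ 2 := by rw [hB] at e1; linarith
  have e2' : V * C = 1 * f ^ 2 := by rw [hC] at e2; linarith
  have e3' : W * (B + C) = 3 * f ^ 2 := by
    have : 241 * (W * (B + C)) = 241 * (3 * f ^ 2) := by
      linear_combination e1 + e2 - W * hB - W * hC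
    linarith
  have cop : ∀ {m n k : ℤ}, Squarefree k → m * n = k * f ^ 2 →
      (∀ g, g ∣ m → g ∣ n → g ∣ U + V - W ∨ g ∣ U + W - V) → IsCoprime m n := by
    intro m n k hk hmn h
    refine isCoprime_of_forall_dvd hc fun g hm hn ↦ ?_
    have hgf : g ∣ 2 * f := (dvd_of_sq_dvd_squarefree_mul_sq hk
      (by rw [← hmn, sq]; exact mul_dvd_mul hm hn)).mul_left _
    refine ⟨?_, hgf⟩
    rcases h g hm hn with h | h
    · exact h
    · refine (Int.pow_dvd_pow_iff two_ne_zero).1 ?_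
      rw [show (U + V - W) ^ 2 = (U + W - V) ^ 2 - 482 * (2 * f) ^ 2 by linarith]
      exact dvd_sub (pow_dvd_pow_of_dvd h 2) ((pow_dvd_pow_of_dvd hgf 2).mul_left _)
  have k1 : IsCoprime U B := cop squarefree_two e1' fun g hm hn ↦ .inl (by
    rw [show U + V - W = U - 241 * B by linarith]
    exact dvd_sub hm (hn.mul_left _))
  have k2 : IsCoprime V C := cop squarefree_one e2' fun g hm hn ↦ .inl (by
    rw [show U + V - W = V + 241 * C by linarith]
    exact dvd_add hm (hn.mul_left _))
  have k3 : IsCoprime W (B + C) := cop squarefree_three e3' fun g hm hn ↦ .inr (by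
    rw [show U + W - V = W + 241 * (B + C) by linarith]
    exact dvd_add hm (hn.mul_left _))
  obtain ⟨α, r, hα, rfl⟩ := exists_eq_dvd_mul_sq two_ne_zero k1 e1'
  obtain ⟨ε, s, hε, rfl⟩ := exists_eq_dvd_mul_sq one_ne_zero k2 e2'
  obtain ⟨γ, t, hγ, rfl⟩ := exists_eq_dvd_mul_sq three_ne_zero k3 e3'
  have f1 : α * ε * (r * s) ^ 2 + 482 * f ^ 2 = α * γ * (r * t) ^ 2 := by linear_combination -e1
  have f2 : α * ε * (r * s) ^ 2 - 241 * f ^ 2 = ε * γ * (s * t) ^ 2 := by linear_combination e2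
  have hα' : α = 1 ∨ α = -1 ∨ α = 2 ∨ α = -2 := by
    have := (Nat.dvd_prime Nat.prime_two).1 (Int.natAbs_dvd_natAbs.2 hα)
    omega
  have hγ' : γ = 1 ∨ γ = -1 ∨ γ = 3 ∨ γ = -3 := by
    have := (Nat.dvd_prime Nat.prime_three).1 (Int.natAbs_dvd_natAbs.2 hγ)
    omega
  obtain ⟨g1, g2, g3⟩ := eq_one_of_covering hα'
    (Int.isUnit_iff.1 (isUnit_of_dvd_one hε)) hγ' hf f1 f2
  rw [g1, g2, one_mul, one_mul] at f1
  rw [g1, g3, one_mul, one_mul] at f2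
  exact ⟨_, _, _, f1, f2⟩

/-- The parities of the coordinates of a primitive solution. -/
lemma even_and_even_add {a b c e : ℤ} (hc : IsCoprime a e)
    (h1 : a ^ 2 + 482 * e ^ 2 = b ^ 2) (h2 : a ^ 2 - 241 * e ^ 2 = c ^ 2) :
    2 ∣ e ∧ 2 ∣ a + b ∧ 2 ∣ a + c := by
  have par : ∀ n : ℤ, n ^ 2 % 4 = n % 2 := fun n ↦ by
    rcases Int.even_or_odd' n with ⟨k, rfl | rfl⟩
    · ring_nf; omega
    · ring_nf; omega
  have hae : ¬ (a % 2 = 0 ∧ e % 2 = 0) := fun ⟨ha, he⟩ ↦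
    Int.prime_two.not_isUnit (hc.isUnit_of_dvd' (Int.dvd_of_emod_eq_zero ha)
      (Int.dvd_of_emod_eq_zero he))
  have h1' : (a % 2 + 2 * (e % 2)) % 4 = b % 2 := by
    rw [← par a, ← par b, ← par e, ← h1]; omega
  have h2' : (a % 2 - e % 2) % 4 = c % 2 := by
    rw [← par a, ← par c, ← par e, ← h2]; omega
  clear par hc h1 h2
  rcases Int.emod_two_eq_zero_or_one a with ha | ha <;>
    rcases Int.emod_two_eq_zero_or_one e with he | he <;>
    rw [ha, he] at h1' h2' hae <;> omega

/-- Halving the point with coordinates `a² / e²`. -/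
lemma exists_half {a b c e : ℤ} (hc : IsCoprime a e) (he : e ≠ 0)
    (h1 : a ^ 2 + 482 * e ^ 2 = b ^ 2) (h2 : a ^ 2 - 241 * e ^ 2 = c ^ 2) :
    ∃ a' b' c' e' : ℤ, e = 2 * e' ∧ a' ^ 2 + 482 * e' ^ 2 = b' ^ 2 ∧
      a' ^ 2 - 241 * e' ^ 2 = c' ^ 2 := by
  obtain ⟨b, hb, hba⟩ := exists_sq_eq_and_dvd_sub (a := a) (b := b) ⟨2 * e ^ 2, by linarith⟩
  obtain ⟨c, hc', hca⟩ := exists_sq_eq_and_dvd_sub (a := a) (b := c) ⟨-e ^ 2, by linarith⟩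
  rw [← hb] at h1
  rw [← hc'] at h2
  clear hb hc'
  obtain ⟨⟨f, rfl⟩, ⟨U, hU⟩, ⟨V, hV⟩⟩ := even_and_even_add hc h1 h2
  obtain ⟨W, hW⟩ : ∃ W, W = U + V - a := ⟨_, rfl⟩
  obtain ⟨β, hβ⟩ := hba
  obtain ⟨δ, hδ⟩ := hca
  have hB : W - V = 241 * (W - V - 120 * β) := by linarith
  have hC : U - W = 241 * (U - W + 120 * δ) := by linarith
  obtain rfl : a = U + V - W := by linarith
  obtain rfl : b = U + W - V := by linarith
  obtain rfl : c = V + W - U := by linarith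
  clear hU hV hW
  obtain ⟨a', b', c', f1, f2⟩ := exists_half_of_half_sums hc (right_ne_zero_of_mul he) hB hC
    (by linarith) (by linarith)
  exact ⟨a', b', c', f, rfl, f1, f2⟩

lemma eq_zero_of_sq_add_sq_sub (n : ℕ) : ∀ a b c e : ℤ, e.natAbs ≤ n →
    a ^ 2 + 482 * e ^ 2 = b ^ 2 → a ^ 2 - 241 * e ^ 2 = c ^ 2 → e = 0 := by
  induction n with
  | zero => intro a b c e he _ _; omega
  | succ n ih =>
    intro a b c e hn h1 h2
    by_contra he
    obtain ⟨g, a', e', hg, he', hc, rfl, rfl⟩ := exists_gcd_factorization a e he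
    obtain ⟨b', rfl⟩ : g ∣ b := (Int.pow_dvd_pow_iff two_ne_zero).1
      ⟨a' ^ 2 + 482 * e' ^ 2, by rw [← h1]; ring⟩
    obtain ⟨c', rfl⟩ : g ∣ c := (Int.pow_dvd_pow_iff two_ne_zero).1
      ⟨a' ^ 2 - 241 * e' ^ 2, by rw [← h2]; ring⟩
    have hg2 : g ^ 2 ≠ 0 := pow_ne_zero 2 hg
    obtain ⟨a₁, b₁, c₁, f, rfl, f1, f2⟩ := exists_half hc he' (b := b') (c := c')
      (mul_left_cancel₀ hg2 (by linear_combination h1))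
      (mul_left_cancel₀ hg2 (by linear_combination h2))
    have hf : f.natAbs ≤ n := by
      have h3 : (2 * f).natAbs ≤ (g * (2 * f)).natAbs := by
        rw [Int.natAbs_mul g]
        exact Nat.le_mul_of_pos_left _ (Int.natAbs_pos.2 hg)
      omega
    exact he' (by rw [ih _ _ _ _ hf f1 f2, mul_zero])

end RationalPointsE2

/-- Every rational point on the elliptic curve `E₂ : y² = x(x + 482)(x − 241)` has `y = 0`;
equivalently, `E₂(ℚ) ≅ ℤ/2ℤ × ℤ/2ℤ` consists only of the 2-torsion points. -/
theorem rational_points_E2 (x y : ℚ) (h : y ^ 2 = x * (x + 482) * (x - 241)) : y = 0 := by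
  obtain ⟨n, d, hd, rfl⟩ : ∃ n d : ℤ, d ≠ 0 ∧ x = n / d :=
    ⟨x.num, x.den, by exact_mod_cast x.den_ne_zero, (Rat.num_div_den x).symm⟩
  obtain ⟨m, k, hk, rfl⟩ : ∃ m k : ℤ, k ≠ 0 ∧ y = m / k :=
    ⟨y.num, y.den, by exact_mod_cast y.den_ne_zero, (Rat.num_div_den y).symm⟩
  have hd' : (d : ℚ) ≠ 0 := by exact_mod_cast hd
  have hk' : (k : ℚ) ≠ 0 := by exact_mod_cast hk
  field_simp at h
  have h' : m ^ 2 * d ^ 3 = k ^ 2 * (n * (n + 482 * d) * (n - 241 * d)) := by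
    have : (m : ℚ) ^ 2 * d ^ 3 = k ^ 2 * (n * (n + 482 * d) * (n - 241 * d)) := by
      linear_combination h
    exact_mod_cast this
  have he := RationalPointsE2.eq_zero_of_sq_add_sq_sub _ ((n ^ 2 + 2 * 241 ^ 2 * d ^ 2) * k)
    (((n + 482 * d) ^ 2 - 6 * 241 ^ 2 * d ^ 2) * k) (((n - 241 * d) ^ 2 - 3 * 241 ^ 2 * d ^ 2) * k)
    (2 * m * d ^ 2) le_rfl
    (by linear_combination 482 * 4 * d * h') (by linear_combination -241 * 4 * d * h')
  have hm : m = 0 := by simpa [hd] using he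
  simp [hm]
end

section
/- Every rational solution (x, y) ∈ ℚ × ℚ of the equation y² = −(x + 241)(x − 241)(x − 482) satisfies y = 0; equivalently, the only rational points of the genus 1 curve E₃ : −y² = (x + 241)(x − 241)(x − 482) are its points of order at most 2. -/
/-- The only square divisor of `3` is `1`. -/
theorem isUnit_of_sq_dvd_three {q : ℤ} (h : q ^ 2 ∣ 3) : IsUnit q := by
  have hle := Int.le_of_dvd (by norm_num) h
  have h1 : q ≤ 1 := by nlinarith
  have h2 : -1 ≤ q := by nlinarith
  rw [Int.isUnit_iff]
  revert h
  interval_cases q <;> decide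

theorem isCoprime_of_sq_eq_add_three_mul_sq {s t r : ℤ} (hs : s ≠ 0) (hsr : IsCoprime s r)
    (h : s ^ 2 = t ^ 2 + 3 * r ^ 2) : IsCoprime s t := by
  refine isCoprime_of_prime_dvd (fun h0 => hs h0.1) fun q hq hqs hqt => hq.not_isUnit ?_
  have hqr : IsCoprime q r := hsr.of_isCoprime_of_dvd_left hqs
  have hd : q ^ 2 ∣ 3 * r ^ 2 := by
    rw [show 3 * r ^ 2 = s ^ 2 - t ^ 2 by rw [h]; ring]
    exact dvd_sub (pow_dvd_pow_of_dvd hqs 2) (pow_dvd_pow_of_dvd hqt 2)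
  exact isUnit_of_sq_dvd_three (hqr.pow.dvd_of_dvd_mul_right hd)

theorem isCoprime_sub_add {r s : ℤ} (h : IsCoprime r s) (hodd : Odd (s - r)) :
    IsCoprime (s - r) (s + r) := by
  have h1 : IsCoprime (s - r) s := by
    obtain ⟨u, v, huv⟩ := h
    exact ⟨-u, u + v, by linear_combination huv⟩
  have h2 : IsCoprime (s - r) 2 := by
    obtain ⟨k, hk⟩ := hodd
    exact ⟨1, -k, by linear_combination hk⟩
  obtain ⟨u, v, huv⟩ := h2.mul_right h1
  exact ⟨u + v, v, by linear_combination huv⟩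

theorem exists_sq_of_mul_eq_sq {x w v : ℤ} (hx : 0 ≤ x) (hxw : IsCoprime x w)
    (h : x * w = v ^ 2) : ∃ A : ℤ, x = A ^ 2 := by
  obtain ⟨A, hA | hA⟩ := Int.sq_of_isCoprime hxw h
  · exact ⟨A, hA⟩
  · exact ⟨0, by nlinarith [sq_nonneg A]⟩

/-- Coprime nonnegative integers whose product is a prime times a square. -/
theorem exists_sq_of_mul_eq_prime_mul_sq {q x w v : ℤ} (hq : Prime q) (hq0 : 0 < q) (hx : 0 ≤ x)
    (hw : 0 ≤ w) (hxw : IsCoprime x w) (h : x * w = q * v ^ 2) :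
    ∃ A B : ℤ, v = A * B ∧ ((x = q * A ^ 2 ∧ w = B ^ 2) ∨ (x = B ^ 2 ∧ w = q * A ^ 2)) := by
  have key : ∀ {x w : ℤ}, 0 ≤ x → 0 ≤ w → IsCoprime x w → x * w = q * v ^ 2 → q ∣ x →
      ∃ A B : ℤ, v = A * B ∧ x = q * A ^ 2 ∧ w = B ^ 2 := by
    rintro _ w hx hw hxw h ⟨x, rfl⟩
    have h' : x * w = v ^ 2 := mul_left_cancel₀ hq.ne_zero (by linear_combination h)
    have hx' : 0 ≤ x := nonneg_of_mul_nonneg_right hx hq0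
    have hxw' : IsCoprime x w := hxw.of_mul_left_right
    obtain ⟨A, rfl⟩ := exists_sq_of_mul_eq_sq hx' hxw' h'
    obtain ⟨B, rfl⟩ := exists_sq_of_mul_eq_sq hw hxw'.symm (by rw [mul_comm]; exact h')
    rcases sq_eq_sq_iff_eq_or_eq_neg.1 (show v ^ 2 = (A * B) ^ 2 by rw [← h']; ring) with e | e
    · exact ⟨A, B, e, rfl, rfl⟩
    · exact ⟨-A, B, by rw [e]; ring, by ring, rfl⟩
  rcases hq.dvd_or_dvd (Dvd.intro _ h.symm) with hd | hd
  · obtain ⟨A, B, h1, h2, h3⟩ := key hx hw hxw h hd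
    exact ⟨A, B, h1, Or.inl ⟨h2, h3⟩⟩
  · obtain ⟨A, B, h1, h2, h3⟩ := key hw hx hxw.symm (by rw [mul_comm]; exact h) hd
    exact ⟨A, B, h1, Or.inr ⟨h3, h2⟩⟩

theorem eq_sq_or_of_mul_eq_sq {q x w y g h : ℤ} (hq : Prime q) (hxw : x * w = y ^ 2)
    (hg : g * x + h * w = q) :
    ∃ t : ℤ, x = t ^ 2 ∨ x = -t ^ 2 ∨ x = q * t ^ 2 ∨ x = -(q * t ^ 2) := by
  by_cases hd : q ∣ x ∧ q ∣ w
  · obtain ⟨⟨x', rfl⟩, ⟨w', rfl⟩⟩ := hd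
    obtain ⟨y', rfl⟩ : q ∣ y :=
      hq.dvd_of_dvd_pow (n := 2) (hxw ▸ (dvd_mul_right q x').mul_right _)
    have hc : IsCoprime x' w' := ⟨g, h, mul_left_cancel₀ hq.ne_zero (by linear_combination hg)⟩
    have hp : x' * w' = y' ^ 2 :=
      mul_left_cancel₀ (pow_ne_zero 2 hq.ne_zero) (by linear_combination hxw)
    obtain ⟨t, rfl | rfl⟩ := Int.sq_of_isCoprime hc hp
    · exact ⟨t, by simp⟩
    · exact ⟨t, by simp⟩
  · have hc : IsCoprime x w := by
      have : x ≠ 0 ∨ w ≠ 0 := by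
        by_contra! h0
        apply hq.ne_zero
        rw [← hg, h0.1, h0.2]; ring
      refine isCoprime_of_prime_dvd (by tauto) fun l hl hlx hlw => hd ?_
      have hlq : l ∣ q := hg ▸ dvd_add (hlx.mul_left g) (hlw.mul_left h)
      have := (hl.associated_of_dvd hq hlq).symm.dvd
      exact ⟨this.trans hlx, this.trans hlw⟩
    obtain ⟨t, rfl | rfl⟩ := Int.sq_of_isCoprime hc hxw
    · exact ⟨t, by simp⟩
    · exact ⟨t, by simp⟩

theorem prime_241 : Prime (241 : ℤ) := Int.prime_iff_natAbs_prime.2 (by norm_num)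

theorem sq_emod_eight (x : ℤ) :
    (x % 2 = 1 ∧ x ^ 2 % 8 = 1) ∨ (x % 4 = 0 ∧ x ^ 2 % 8 = 0) ∨ (x % 4 = 2 ∧ x ^ 2 % 8 = 4) := by
  have key : (x % 8) ^ 2 % 8 = x ^ 2 % 8 := (Int.mod_modEq x 8).pow 2
  have : x % 8 = 0 ∨ x % 8 = 1 ∨ x % 8 = 2 ∨ x % 8 = 3 ∨ x % 8 = 4 ∨ x % 8 = 5 ∨ x % 8 = 6 ∨
      x % 8 = 7 := by omega
  rcases this with h | h | h | h | h | h | h | h <;> rw [h] at key <;> norm_num at key <;> omega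

theorem sq_emod_three (x : ℤ) : (x % 3 = 0 ∧ x ^ 2 % 3 = 0) ∨ (x % 3 ≠ 0 ∧ x ^ 2 % 3 = 1) := by
  have key : (x % 3) ^ 2 % 3 = x ^ 2 % 3 := (Int.mod_modEq x 3).pow 2
  have : x % 3 = 0 ∨ x % 3 = 1 ∨ x % 3 = 2 := by omega
  rcases this with h | h | h <;> rw [h] at key <;> norm_num at key <;> omega

theorem norm_sqrt_three_emod_eight {U V z : ℤ} (hU : 0 < U) (hU2 : U % 2 = 1) (hV : V % 4 = 0)
    (hUV : IsCoprime U V) (h : U ^ 2 - 3 * V ^ 2 = z ^ 2) : (U + V) % 8 = 1 ∨ (U + V) % 8 = 3 := by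
  have hUz : IsCoprime U z := isCoprime_of_sq_eq_add_three_mul_sq hU.ne' hUV (by linear_combination h)
  obtain ⟨v, rfl⟩ : ∃ v, V = 4 * v := ⟨V / 4, by omega⟩
  have hz : z % 2 = 1 := by
    rcases sq_emod_eight U with h1 | h1 | h1 <;> rcases sq_emod_eight z with h2 | h2 | h2 <;>
    rcases sq_emod_eight v with h3 | h3 | h3 <;> ring_nf at h <;> omega
  obtain ⟨w, hw⟩ : ∃ w, U - z = 2 * w := ⟨(U - z) / 2, by omega⟩
  have hle : z ^ 2 ≤ U ^ 2 := by nlinarith [sq_nonneg v]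
  have habs := abs_le_of_sq_le_sq' hle hU.le
  obtain rfl : U = z + 2 * w := by linarith
  have hc : IsCoprime (z + w) w := by
    obtain ⟨α, β, hαβ⟩ := hUz
    exact ⟨α + β, α - β, by linear_combination hαβ⟩
  obtain ⟨a, b, hab, hh⟩ := exists_sq_of_mul_eq_prime_mul_sq (q := 3) (v := 2 * v) Int.prime_three
    (by norm_num) (by linarith) (by linarith) hc (by linarith)
  obtain ⟨hN⟩ : Nonempty (z + 2 * w = 3 * a ^ 2 + b ^ 2) := by
    rcases hh with hh | hh <;> exact ⟨by linarith⟩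
  rw [hN] at hU2 ⊢
  have hv : 4 * v = 2 * (a * b) := by linarith
  rw [hv]
  have : ∀ n : ℤ, n % 2 = 0 ∨ n % 2 = 1 := by omega
  rcases this a with ha | ha <;> rcases this b with hb | hb
  · obtain ⟨a, rfl⟩ : ∃ n, a = 2 * n := ⟨a / 2, by omega⟩
    obtain ⟨b, rfl⟩ : ∃ n, b = 2 * n := ⟨b / 2, by omega⟩
    ring_nf at hU2; omega
  · obtain ⟨a, rfl⟩ : ∃ n, a = 2 * n := ⟨a / 2, by omega⟩
    obtain ⟨b, rfl⟩ : ∃ n, b = 2 * n + 1 := ⟨b / 2, by omega⟩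
    obtain ⟨k, hk⟩ := Int.even_mul_succ_self a
    obtain ⟨l, hl⟩ := Int.even_mul_succ_self b
    left
    have : 3 * (2 * a) ^ 2 + (2 * b + 1) ^ 2 + 2 * (2 * a * (2 * b + 1)) =
      8 * (a ^ 2 + a * b + k + l) + 1 := by linear_combination 4 * hk + 4 * hl
    omega
  · obtain ⟨a, rfl⟩ : ∃ n, a = 2 * n + 1 := ⟨a / 2, by omega⟩
    obtain ⟨b, rfl⟩ : ∃ n, b = 2 * n := ⟨b / 2, by omega⟩
    obtain ⟨k, hk⟩ := Int.even_mul_succ_self a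
    obtain ⟨l, hl⟩ := Int.even_mul_succ_self b
    right
    have : 3 * (2 * a + 1) ^ 2 + (2 * b) ^ 2 + 2 * ((2 * a + 1) * (2 * b)) =
      8 * (3 * k + a * b + l) + 3 := by linear_combination 12 * hk + 4 * hl
    omega
  · obtain ⟨a, rfl⟩ : ∃ n, a = 2 * n + 1 := ⟨a / 2, by omega⟩
    obtain ⟨b, rfl⟩ : ∃ n, b = 2 * n + 1 := ⟨b / 2, by omega⟩
    ring_nf at hU2; omega

/-- Division by `17 ± 4√3`, of norm `241`, in `ℤ[√3]`. -/
theorem exists_norm_sqrt_three {X Y z : ℤ} (hX : 0 < X) (h : 241 * z ^ 2 = X ^ 2 - 3 * Y ^ 2) :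
    ∃ δ U V : ℤ, (δ = 1 ∨ δ = -1) ∧ X = 17 * U + 12 * V ∧ Y = δ * (17 * V + 4 * U) ∧ 0 < U ∧
      U ^ 2 - 3 * V ^ 2 = z ^ 2 := by
  have key : ∀ Y : ℤ, 241 * z ^ 2 = X ^ 2 - 3 * Y ^ 2 → 241 ∣ 17 * Y - 4 * X → ∃ U V : ℤ,
      X = 17 * U + 12 * V ∧ Y = 17 * V + 4 * U ∧ 0 < U ∧ U ^ 2 - 3 * V ^ 2 = z ^ 2 := by
    rintro Y h ⟨V, hV⟩
    obtain ⟨U, hU⟩ : (241 : ℤ) ∣ 17 * X - 12 * Y := by omega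
    have hX' : X = 17 * U + 12 * V := by omega
    have hY' : Y = 17 * V + 4 * U := by omega
    refine ⟨U, V, hX', hY', ?_, ?_⟩
    · have : 12 * Y < 17 * X := by
        apply lt_of_pow_lt_pow_left₀ 2 (by positivity)
        nlinarith [sq_nonneg z, sq_nonneg Y, pow_pos hX 2]
      linarith
    · rw [hX', hY'] at h
      linarith
  have hd : (241 : ℤ) ∣ (17 * Y - 4 * X) * (17 * Y + 4 * X) :=
    ⟨Y ^ 2 - 16 * z ^ 2, by linear_combination 16 * h⟩
  rcases prime_241.dvd_or_dvd hd with hd | hd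
  · obtain ⟨U, V, h1, h2, h3, h4⟩ := key Y h hd
    exact ⟨1, U, V, by simp, h1, by linarith, h3, h4⟩
  · obtain ⟨U, V, h1, h2, h3, h4⟩ := key (-Y) (by linear_combination h) (by omega)
    exact ⟨-1, U, V, by simp, h1, by linarith, h3, h4⟩

theorem isCoprime_of_linear {U V X Y α β γ δ : ℤ} (h : IsCoprime X Y) (hX : X = α * U + β * V)
    (hY : Y = γ * U + δ * V) : IsCoprime U V := by
  obtain ⟨u, v, huv⟩ := h
  exact ⟨u * α + v * γ, u * β + v * δ, by rw [hX, hY] at huv; linear_combination huv⟩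

/-- The two-covering with classes `(2, 6, 3)` has no rational points. -/
theorem no_points_two_six_three {r s z t : ℤ} (hr : 0 < r) (hz : z % 2 = 1)
    (hrz : IsCoprime r (241 * z ^ 2)) (h1 : r ^ 2 - 3 * s ^ 2 = 241 * z ^ 2)
    (h2 : r ^ 2 = t ^ 2 + s ^ 2) : False := by
  have hp : r % 2 = 1 ∧ s % 4 = 0 := by
    rcases sq_emod_eight r with h3 | h3 | h3 <;> rcases sq_emod_eight s with h4 | h4 | h4 <;>
    rcases sq_emod_eight t with h5 | h5 | h5 <;> rcases sq_emod_eight z with h6 | h6 | h6 <;> omega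
  have hrs : IsCoprime r s := by
    rw [← h1] at hrz
    have : IsCoprime r (3 * s ^ 2) := by
      obtain ⟨u, v, huv⟩ := hrz
      exact ⟨u + v * r, -v, by linear_combination huv⟩
    exact (IsCoprime.pow_right_iff two_pos).1 this.of_mul_right_right
  obtain ⟨δ, U, V, hδ, hX, hY, hU, hz'⟩ := exists_norm_sqrt_three hr h1.symm
  have hUV : IsCoprime U V :=
    isCoprime_of_linear (γ := 4 * δ) (δ := 17 * δ) hrs hX (by rw [hY]; ring)
  have hV : V % 4 = 0 := by rcases hδ with rfl | rfl <;> omega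
  have hK := norm_sqrt_three_emod_eight hU (by omega) hV hUV hz'
  have hs' : (δ * s) ^ 2 = s ^ 2 := by rcases hδ with rfl | rfl <;> ring
  have hc : IsCoprime (r - δ * s) (r + δ * s) := by
    apply isCoprime_sub_add
    · rcases hδ with rfl | rfl
      · simpa using hrs.symm
      · simpa using hrs.symm.neg_left
    · rw [Int.odd_iff]; rcases hδ with rfl | rfl <;> omega
  have hle : (δ * s) ^ 2 ≤ r ^ 2 := by rw [hs', h2]; nlinarith [sq_nonneg t]
  have habs := abs_le_of_sq_le_sq' hle hr.le
  obtain ⟨A, hA⟩ := exists_sq_of_mul_eq_sq (x := r + δ * s) (v := t) (by linarith) hc.symm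
    (by linear_combination h2 - hs')
  have hA8 := sq_emod_eight A
  have : r + δ * s = 21 * U + 29 * V := by rcases hδ with rfl | rfl <;> linarith
  omega

theorem parity_of_eqs {r s z t : ℤ} (hrz : ¬ (r % 2 = 0 ∧ z % 2 = 0))
    (h1 : 3 * t ^ 2 + r ^ 2 = 241 * z ^ 2) (h2 : s ^ 2 = r ^ 2 + 2 * t ^ 2) :
    r % 2 = 1 ∧ s % 2 = 1 ∧ t % 4 = 0 := by
  have h3 : 3 * s ^ 2 = r ^ 2 + 2 * (241 * z ^ 2) := by linear_combination 3 * h2 + 2 * h1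
  have hz := sq_emod_eight z
  have hr := sq_emod_eight r
  have hrs : r % 2 = 1 ∧ s % 2 = 1 ∧ z % 2 = 1 := by
    have hs := sq_emod_eight s
    omega
  have ht := sq_emod_eight t
  omega

/-- The two-covering with classes `(-1, -3, 3)` has no rational points. -/
theorem no_points_neg_one_neg_three_three {r s z t : ℤ} (hr : 0 < r) (hs : 0 < s)
    (hrz : IsCoprime r (241 * z ^ 2)) (h1 : 3 * t ^ 2 + r ^ 2 = 241 * z ^ 2)
    (h2 : s ^ 2 = r ^ 2 + 2 * t ^ 2) : False := by
  obtain ⟨hr2, hs2, ht⟩ : r % 2 = 1 ∧ s % 2 = 1 ∧ t % 4 = 0 := by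
    refine parity_of_eqs (z := z) ?_ h1 h2
    rintro ⟨h4, h5⟩
    have h6 : (2 : ℤ) ∣ 241 * z ^ 2 :=
      ((Int.dvd_of_emod_eq_zero h5).pow two_ne_zero).mul_left 241
    have := hrz.isUnit_of_dvd' (Int.dvd_of_emod_eq_zero h4) h6
    norm_num [Int.isUnit_iff] at this
  have hrs : IsCoprime r s := by
    have h3 : IsCoprime r (2 * (241 * z ^ 2)) := by
      refine IsCoprime.mul_right ?_ hrz
      exact ⟨1, -(r / 2), by omega⟩
    have : IsCoprime r (3 * s ^ 2) := by
      obtain ⟨u, v, huv⟩ := h3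
      exact ⟨u - v * r, v, by linear_combination huv + 3 * v * h2 - v * 2 * (-h1)⟩
    exact (IsCoprime.pow_right_iff two_pos).1 this.of_mul_right_right
  obtain ⟨τ, rfl⟩ : ∃ n, t = 2 * n := ⟨t / 2, by omega⟩
  obtain ⟨w, hw⟩ : ∃ w, s - r = 2 * w := ⟨(s - r) / 2, by omega⟩
  have hle : r ^ 2 ≤ s ^ 2 := by nlinarith [sq_nonneg τ]
  have habs := abs_le_of_sq_le_sq' hle hs.le
  obtain rfl : s = r + 2 * w := by linarith
  have hc : IsCoprime (r + w) w := by
    obtain ⟨α, β, hαβ⟩ := hrs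
    exact ⟨α + β, β - α, by linear_combination hαβ⟩
  obtain ⟨C, D, rfl, hh⟩ := exists_sq_of_mul_eq_prime_mul_sq (q := 2) (v := τ) Int.prime_two
    (by norm_num) (by linarith) (by linarith) hc (by linarith)
  have hr2 : r ^ 2 = (D ^ 2 - 2 * C ^ 2) ^ 2 := by
    rcases hh with ⟨h3, h4⟩ | ⟨h3, h4⟩
    · rw [show r = 2 * C ^ 2 - D ^ 2 by linarith]; ring
    · rw [show r = D ^ 2 - 2 * C ^ 2 by linarith]
  have hsD : r + 2 * w = 2 * C ^ 2 + D ^ 2 := by rcases hh with h3 | h3 <;> linarith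
  have hCD : IsCoprime (2 * C ^ 2) (D ^ 2) := by
    rcases hh with ⟨h3, h4⟩ | ⟨h3, h4⟩
    · rwa [← h3, ← h4]
    · rw [← h3, ← h4]; exact hc.symm
  have hD := sq_emod_eight D
  have hD1 : D % 2 = 1 := by omega
  have hC : C % 2 = 0 := by
    have h3 : (C * D) % 2 = 0 := by omega
    rcases Int.emod_two_eq_zero_or_one C with h | h
    · exact h
    · rw [Int.mul_emod, h, hD1] at h3; norm_num at h3
  have hC8 : C ^ 2 % 4 = 0 := by
    have := sq_emod_eight C
    omega
  obtain ⟨δ, U, V, hδ, hX, hY, hU, hz'⟩ := exists_norm_sqrt_three (X := D ^ 2 + 4 * C ^ 2)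
    (Y := 2 * C ^ 2) (z := z) (by omega) (by rw [hr2] at h1; linear_combination -h1)
  have hXY : IsCoprime (D ^ 2 + 4 * C ^ 2) (2 * C ^ 2) := by
    obtain ⟨u, v, huv⟩ := hCD
    exact ⟨v, u - 2 * v, by linear_combination huv⟩
  have hUV : IsCoprime U V :=
    isCoprime_of_linear (γ := 4 * δ) (δ := 17 * δ) hXY hX (by rw [hY]; ring)
  have hV : V % 8 = 4 ∧ U % 8 = 1 := by rcases hδ with rfl | rfl <;> omega
  have hK := norm_sqrt_three_emod_eight hU (by omega) (by omega) hUV hz'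
  omega

theorem zmod_241_facts : (241 : ZMod 241) = 0 ∧ (1446 : ZMod 241) = 0 ∧ (2 : ZMod 241) ≠ 0 ∧
    (-37 : ZMod 241) ≠ 0 := by
  decide +kernel

theorem not_isSquare_zmod_241 : ¬ IsSquare (39 : ZMod 241) := by decide +kernel

theorem isSquare_zmod_241 : IsSquare (-37 * 39 : ZMod 241) ∧ IsSquare (3 : ZMod 241) := by
  decide +kernel

/-- The two-covering with classes `(-2, -2, 1)` has no rational points. -/
theorem no_points_neg_two_neg_two_one {r s z t : ℤ} (hs : 0 < s) (hz : z % 2 = 1)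
    (hrz : IsCoprime r (241 * z ^ 2)) (h1 : t ^ 2 + 2 * r ^ 2 = 241 * z ^ 2)
    (h2 : s ^ 2 = r ^ 2 + 241 * z ^ 2) : False := by
  have : Fact (Nat.Prime 241) := ⟨by norm_num⟩
  have hp : r % 2 = 0 ∧ s % 2 = 1 ∧ t % 2 = 1 := by
    rcases sq_emod_eight r with h3 | h3 | h3 <;> rcases sq_emod_eight s with h4 | h4 | h4 <;>
    rcases sq_emod_eight t with h5 | h5 | h5 <;> rcases sq_emod_eight z with h6 | h6 | h6 <;> omega
  have hrs : IsCoprime r s := by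
    have : IsCoprime r (s ^ 2) := by
      obtain ⟨u, v, huv⟩ := hrz
      exact ⟨u - v * r, v, by linear_combination huv + v * h2⟩
    exact (IsCoprime.pow_right_iff two_pos).1 this
  have hst : IsCoprime s t :=
    isCoprime_of_sq_eq_add_three_mul_sq hs.ne' hrs.symm (by linear_combination h2 - h1)
  have hs241 : ((s : ℤ) : ZMod 241) ≠ 0 := by
    intro h0
    have h0' : (241 : ℤ) ∣ s := (ZMod.intCast_zmod_eq_zero_iff_dvd s 241).1 h0
    have h3 : (241 : ℤ) ∣ r := by
      apply prime_241.dvd_of_dvd_pow (n := 2)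
      rw [show r ^ 2 = s ^ 2 - 241 * z ^ 2 by linarith]
      exact dvd_sub (h0'.pow two_ne_zero) (dvd_mul_right _ _)
    have := hrs.isUnit_of_dvd' h3 h0'
    norm_num [Int.isUnit_iff] at this
  have hc := isCoprime_sub_add hrs (by rw [Int.odd_iff]; omega)
  have hle : r ^ 2 ≤ s ^ 2 := by nlinarith [sq_nonneg z]
  have habs := abs_le_of_sq_le_sq' hle hs.le
  obtain ⟨A, B, -, hAB⟩ := exists_sq_of_mul_eq_prime_mul_sq (v := z) prime_241
    (by norm_num) (by linarith) (by linarith) hc (by linear_combination h2)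
  obtain ⟨hB⟩ : Nonempty (2 * s = 241 * A ^ 2 + B ^ 2) := by
    rcases hAB with h | h <;> exact ⟨by linarith⟩
  obtain ⟨w, hw⟩ : ∃ w, s - t = 2 * w := ⟨(s - t) / 2, by omega⟩
  obtain ⟨ρ, rfl⟩ : ∃ n, r = 2 * n := ⟨r / 2, by omega⟩
  have hle' : t ^ 2 ≤ s ^ 2 := by nlinarith [sq_nonneg ρ]
  have habs' := abs_le_of_sq_le_sq' hle' hs.le
  obtain rfl : s = t + 2 * w := by linarith
  have hc' : IsCoprime (t + w) w := by
    obtain ⟨α, β, hαβ⟩ := hst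
    exact ⟨α + β, α - β, by linear_combination hαβ⟩
  obtain ⟨C, D, -, hCD⟩ := exists_sq_of_mul_eq_prime_mul_sq (q := 3) (v := ρ) Int.prime_three
    (by norm_num) (by linarith) (by linarith) hc' (by linarith)
  generalize hS : t + 2 * w = s at *
  obtain ⟨e0, e1, e2, e37⟩ := zmod_241_facts
  have hB' : (2 * s : ZMod 241) = B ^ 2 := by
    have := congrArg (Int.cast : ℤ → ZMod 241) hB
    push_cast at this
    rw [this, e0]; ring
  have hsq3 : IsSquare (2 * (s + t) : ZMod 241) := by
    have h3 : s + t = 2 * (t + w) := by linarith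
    have h4 : (2 * (s + t) : ZMod 241) = 2 ^ 2 * ((t + w : ℤ) : ZMod 241) := by
      have := congrArg (Int.cast : ℤ → ZMod 241) h3
      push_cast at this ⊢
      rw [this]; ring
    rw [h4]
    refine (IsSquare.sq _).mul ?_
    rcases hCD with h | h
    · rw [h.1]; push_cast; exact isSquare_zmod_241.2.mul (IsSquare.sq _)
    · rw [h.1]; push_cast; exact IsSquare.sq _
  have ht : ((t : ZMod 241) - 38 * s) * (t + 38 * s) = 0 := by
    have h3 : t ^ 2 + 2 * s ^ 2 = 241 * (3 * z ^ 2) := by linear_combination h1 + 2 * h2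
    have := congrArg (Int.cast : ℤ → ZMod 241) h3
    push_cast at this
    rw [e0] at this
    linear_combination this - s ^ 2 * e1
  have hs2 : IsSquare (2 * s : ZMod 241) := hB' ▸ IsSquare.sq _
  have h2s : (2 * s : ZMod 241) ≠ 0 := mul_ne_zero e2 hs241
  rcases mul_eq_zero.1 ht with h | h
  · apply not_isSquare_zmod_241
    have h3 : (39 : ZMod 241) = 2 * (s + t) / (2 * s) := by
      rw [eq_div_iff h2s]; linear_combination (-2) * h
    rw [h3]; exact hsq3.div hs2
  · apply not_isSquare_zmod_241
    have h3 : (-37 : ZMod 241) = 2 * (s + t) / (2 * s) := by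
      rw [eq_div_iff h2s]; linear_combination (-2) * h
    have h4 : IsSquare (-37 : ZMod 241) := by rw [h3]; exact hsq3.div hs2
    have h5 := isSquare_zmod_241.1.div h4
    rwa [mul_div_cancel_left₀ _ e37] at h5

theorem exists_solution_of_cross_eq {N K L M ε : ℤ} (hε : ε ^ 2 = 1) (hL : L ≠ 0)
    (h : L * (N - ε * K) = -(M * (ε * N + 2 * K))) (hLM : IsCoprime L M) (hNK : IsCoprime N K) :
    ∃ a b e : ℤ, e ∣ 3 ∧ a * b * (a - 2 * b) * (a + b) = N * K * (L * M) * e ^ 2 := by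
  obtain ⟨e, he⟩ : L ∣ ε * N + 2 * K :=
    hLM.dvd_of_dvd_mul_left ((dvd_neg).1 (h ▸ dvd_mul_right _ _))
  have he' : N - ε * K = -(M * e) := mul_left_cancel₀ hL (by rw [h, he]; ring)
  refine ⟨-ε * N, K, e, ?_, ?_⟩
  · obtain ⟨u, v, huv⟩ := hNK
    refine ⟨u * ε * (L - 2 * M * ε) + v * (L + ε * M), ?_⟩
    linear_combination (-3) * huv + (u * ε + v) * he + (2 * u - v * ε) * he' +
      (3 * u * N - v * K - 2 * u * N + 2 * u * M * e + 2 * v * K - 2 * u * N - 2 * v * K) * hε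
  · linear_combination (-ε ^ 2 * N * K * (N - ε * K)) * he - ε ^ 2 * N * K * L * e * he' +
      (N * K * (L * M) * e ^ 2 - 2 * ε * N * K ^ 3 - ε ^ 2 * N ^ 2 * K ^ 2) * hε

theorem exists_sq_of_mul_eq_two_mul_prime_mul_sq {q x w v : ℤ} (hq : Prime q) (hq0 : 0 < q)
    (hx : 0 ≤ x) (hw : 0 ≤ w) (hxw : IsCoprime x w) (h : x * w = 2 * (q * v ^ 2)) :
    ∃ C D : ℤ, v = C * D ∧ (x + w = 2 * (q * C ^ 2) + D ^ 2 ∨ x + w = 2 * C ^ 2 + q * D ^ 2) := by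
  have key : ∀ {x w : ℤ}, 0 ≤ x → 0 ≤ w → IsCoprime x w → x * w = 2 * (q * v ^ 2) → 2 ∣ x →
      ∃ C D : ℤ, v = C * D ∧
        (x + w = 2 * (q * C ^ 2) + D ^ 2 ∨ x + w = 2 * C ^ 2 + q * D ^ 2) := by
    rintro _ w hx hw hxw h ⟨x, rfl⟩
    obtain ⟨A, B, hv, ⟨h1, h2⟩ | ⟨h1, h2⟩⟩ := exists_sq_of_mul_eq_prime_mul_sq (v := v) hq hq0
      (by linarith) hw hxw.of_mul_left_right (by linarith)
    · exact ⟨A, B, hv, Or.inl (by rw [h1, h2])⟩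
    · exact ⟨B, A, by rw [hv]; ring, Or.inr (by rw [h1, h2])⟩
  rcases Int.prime_two.dvd_or_dvd (Dvd.intro _ h.symm) with hd | hd
  · exact key hx hw hxw h hd
  · rw [add_comm x w]
    exact key hw hx hxw.symm (by rw [mul_comm]; exact h) hd

/-- Fermat descent: a solution in the trivial two-descent class produces a smaller solution. -/
theorem exists_smaller {r s t z : ℤ} (hr : 0 < r) (hs : 0 < s) (ht : 0 < t) (hz : 0 < z)
    (hrz : IsCoprime r (241 * z ^ 2)) (h1 : r ^ 2 - 2 * (241 * z ^ 2) = s ^ 2)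
    (h2 : r ^ 2 + 241 * z ^ 2 = t ^ 2) :
    ∃ a b y : ℤ, 241 * a * b * (a - 2 * b) * (a + b) = y ^ 2 ∧ y ≠ 0 ∧ 2 * |y| ≤ 723 * z := by
  have hp : z % 2 = 0 := by
    rcases sq_emod_eight r with h4 | h4 | h4 <;> rcases sq_emod_eight s with h5 | h5 | h5 <;>
    rcases sq_emod_eight z with h6 | h6 | h6 <;> omega
  obtain ⟨ζ, rfl⟩ : ∃ n, z = 2 * n := ⟨z / 2, by omega⟩
  have hr2 : r % 2 = 1 := by
    by_contra hr2
    have h6 : (2 : ℤ) ∣ 241 * (2 * ζ) ^ 2 := ⟨482 * ζ ^ 2, by ring⟩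
    have := hrz.isUnit_of_dvd' (show (2 : ℤ) ∣ r by omega) h6
    norm_num [Int.isUnit_iff] at this
  have hst2 : s % 2 = 1 ∧ t % 2 = 1 := by
    rcases sq_emod_eight r with h4 | h4 | h4 <;> rcases sq_emod_eight s with h5 | h5 | h5 <;>
    rcases sq_emod_eight t with h6 | h6 | h6 <;> ring_nf at h1 h2 <;> omega
  have hrt : IsCoprime r t := by
    have : IsCoprime r (t ^ 2) := by
      obtain ⟨u, v, huv⟩ := hrz
      exact ⟨u - v * r, v, by linear_combination huv - v * h2⟩
    exact (IsCoprime.pow_right_iff two_pos).1 this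
  have hrs : IsCoprime r s := by
    have h3 : IsCoprime r (2 * (241 * (2 * ζ) ^ 2)) := by
      refine IsCoprime.mul_right ?_ hrz
      exact ⟨1, -(r / 2), by omega⟩
    have : IsCoprime r (s ^ 2) := by
      obtain ⟨u, v, huv⟩ := h3
      exact ⟨u + v * r, -v, by linear_combination huv + v * h1⟩
    exact (IsCoprime.pow_right_iff two_pos).1 this
  have hrt' := abs_le_of_sq_le_sq' (show r ^ 2 ≤ t ^ 2 by nlinarith [sq_nonneg ζ]) ht.le
  have hsr' := abs_le_of_sq_le_sq' (show s ^ 2 ≤ r ^ 2 by nlinarith [sq_nonneg ζ]) hr.le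
  obtain ⟨w, hw⟩ : ∃ w, t - r = 2 * w := ⟨(t - r) / 2, by omega⟩
  obtain ⟨x, hx⟩ : ∃ x, r - s = 2 * x := ⟨(r - s) / 2, by omega⟩
  obtain rfl : t = r + 2 * w := by linarith
  have hc : IsCoprime (r + w) w := by
    obtain ⟨α, β, hαβ⟩ := hrt
    exact ⟨α + β, β - α, by linear_combination hαβ⟩
  obtain ⟨A, B, hAB, hhAB⟩ := exists_sq_of_mul_eq_prime_mul_sq (v := ζ) prime_241
    (by norm_num) (by linarith) (by linarith) hc (by linarith)
  obtain ⟨ε, hε, hrε⟩ : ∃ ε : ℤ, ε ^ 2 = 1 ∧ r = ε * (B ^ 2 - 241 * A ^ 2) := by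
    rcases hhAB with ⟨h3, h4⟩ | ⟨h3, h4⟩
    · exact ⟨-1, by norm_num, by linarith⟩
    · exact ⟨1, by norm_num, by linarith⟩
  have hcAB : IsCoprime (B ^ 2) (241 * A ^ 2) := by
    rcases hhAB with ⟨h3, h4⟩ | ⟨h3, h4⟩
    · rw [← h3, ← h4]; exact hc.symm
    · rwa [← h3, ← h4]
  obtain rfl : s = r - 2 * x := by linarith
  have hc' : IsCoprime (r - x) x := by
    obtain ⟨α, β, hαβ⟩ := hrs
    exact ⟨α + β, α - β, by linear_combination hαβ⟩
  obtain ⟨C, D, hCD, hhCD⟩ := exists_sq_of_mul_eq_two_mul_prime_mul_sq (v := ζ) prime_241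
    (by norm_num) (by linarith) (by linarith) hc' (by linarith)
  rw [sub_add_cancel] at hhCD
  have hζ : 0 < ζ := by linarith
  have hA0 : A ≠ 0 := by rintro rfl; simp at hAB; omega
  obtain ⟨m, n, ⟨k, rfl⟩, ⟨l, rfl⟩, rfl⟩ :=
    exists_dvd_and_dvd_of_dvd_mul (show A ∣ C * D from ⟨B, by rw [← hCD, hAB]⟩)
  obtain rfl : B = k * l := mul_left_cancel₀ hA0 (by rw [← hAB, hCD]; ring)
  have hl0 : l ^ 2 ≠ 0 := by
    refine pow_ne_zero 2 ?_
    rintro rfl; simp at hAB; omega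
  have hkl : l ^ 2 ∣ (k * l) ^ 2 ∧ k ^ 2 ∣ (k * l) ^ 2 := ⟨⟨k ^ 2, by ring⟩, ⟨l ^ 2, by ring⟩⟩
  obtain ⟨a, b, e, he, hab⟩ : ∃ a b e : ℤ, e ∣ 3 ∧
      241 * (a * b * (a - 2 * b) * (a + b)) = (241 * ζ * e) ^ 2 := by
    rcases hhCD with h3 | h3
    · obtain ⟨a, b, e, he, hab⟩ := exists_solution_of_cross_eq (N := n ^ 2) (K := k ^ 2)
        (L := l ^ 2) (M := 241 * m ^ 2) hε hl0
        (by linear_combination hrε - h3)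
        (hcAB.mono hkl.1 ⟨n ^ 2, by ring⟩) (hcAB.mono hkl.2 ⟨241 * m ^ 2, by ring⟩).symm
      exact ⟨a, b, e, he, by rw [hab, hAB]; ring⟩
    · obtain ⟨a, b, e, he, hab⟩ := exists_solution_of_cross_eq (N := 241 * n ^ 2) (K := k ^ 2)
        (L := l ^ 2) (M := m ^ 2) hε hl0
        (by linear_combination hrε - h3)
        (hcAB.mono hkl.1 ⟨241 * n ^ 2, by ring⟩) (hcAB.mono hkl.2 ⟨m ^ 2, by ring⟩).symm
      exact ⟨a, b, e, he, by rw [hab, hAB]; ring⟩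
  refine ⟨a, b, 241 * ζ * e, by rw [← hab]; ring, ?_, ?_⟩
  · have : e ≠ 0 := by rintro rfl; norm_num at he
    positivity
  · have : |e| ≤ 3 := Int.le_of_dvd (by norm_num) ((abs_dvd e 3).2 he)
    rw [abs_mul, abs_of_pos (show 0 < 241 * ζ by linarith)]
    nlinarith

theorem exists_coprime {a b y : ℤ} (h : 241 * a * b * (a - 2 * b) * (a + b) = y ^ 2)
    (hy : y ≠ 0) : ∃ g a' b' y' : ℤ, a = g * a' ∧ b = g * b' ∧ IsCoprime a' b' ∧ y' ≠ 0 ∧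
      |y'| ≤ |y| ∧ 241 * a' * b' * (a' - 2 * b') * (a' + b') = y' ^ 2 := by
  have ha : a ≠ 0 := by
    rintro rfl
    exact hy (by simpa using h.symm)
  obtain ⟨a', b', hc, ha', hb'⟩ := Int.exists_gcd_one (m := a) (n := b) (Int.gcd_pos_of_ne_zero_left b ha)
  set g : ℤ := (Int.gcd a b : ℤ)
  have hg : g ≠ 0 := by
    intro hg
    rw [hg, mul_zero] at ha'
    exact ha ha'
  obtain ⟨y', rfl⟩ : g ^ 2 ∣ y := by
    rw [← Int.pow_dvd_pow_iff (n := 2) two_ne_zero, ← h, ha', hb']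
    exact ⟨241 * a' * b' * (a' - 2 * b') * (a' + b'), by ring⟩
  refine ⟨g, a', b', y', by rw [ha', mul_comm], by rw [hb', mul_comm],
    Int.isCoprime_iff_gcd_eq_one.2 hc, right_ne_zero_of_mul hy, ?_, ?_⟩
  · rw [abs_mul]
    exact le_mul_of_one_le_left (abs_nonneg _) (Int.one_le_abs (pow_ne_zero 2 hg))
  · apply mul_left_cancel₀ (pow_ne_zero 4 hg)
    rw [ha', hb'] at h
    linear_combination h

/-- Translating by a two-torsion point, one may assume that `241` divides the denominator. -/
theorem exists_dvd_right {a b y : ℤ} (h : 241 * a * b * (a - 2 * b) * (a + b) = y ^ 2)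
    (hy : y ≠ 0) (hab : IsCoprime a b) : ∃ a' b' y' : ℤ, ¬ 241 ∣ a' ∧ 241 ∣ b' ∧ y' ≠ 0 ∧
      |y'| ≤ 6 * |y| ∧ 241 * a' * b' * (a' - 2 * b') * (a' + b') = y' ^ 2 := by
  have hn : ¬ ((241 : ℤ) ∣ a ∧ (241 : ℤ) ∣ b) := by
    rintro ⟨h1, h2⟩
    have := hab.isUnit_of_dvd' h1 h2
    norm_num [Int.isUnit_iff] at this
  have hy' := abs_nonneg y
  have hd : (241 : ℤ) ∣ a * b * (a - 2 * b) * (a + b) := by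
    obtain ⟨k, rfl⟩ : (241 : ℤ) ∣ y :=
      prime_241.dvd_of_dvd_pow (n := 2) ⟨a * b * (a - 2 * b) * (a + b), by rw [← h]; ring⟩
    exact ⟨k ^ 2, by linarith⟩
  rcases prime_241.dvd_or_dvd hd with hd | hd
  · rcases prime_241.dvd_or_dvd hd with hd | hd
    · rcases prime_241.dvd_or_dvd hd with hd | hd
      · refine ⟨-2 * b, a, 2 * y, by omega, hd, by simpa using hy, ?_, by linear_combination 4 * h⟩
        rw [abs_mul, abs_two]; linarith
      · exact ⟨a, b, y, fun h0 => hn ⟨h0, hd⟩, hd, hy, by linarith, h⟩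
    · refine ⟨-2 * (a + b), 2 * b - a, 6 * y, by omega, by omega, by simpa using hy, ?_,
        by linear_combination 36 * h⟩
      rw [abs_mul, abs_of_pos (show (0 : ℤ) < 6 by norm_num)]
  · refine ⟨2 * b - a, a + b, 3 * y, by omega, hd, by simpa using hy, ?_,
      by linear_combination 9 * h⟩
    rw [abs_mul, abs_of_pos (show (0 : ℤ) < 3 by norm_num)]; linarith

theorem exists_eq_mul_sq {d x k : ℤ} (hd : d ∣ 6) (h : d * x = k ^ 2) : ∃ s, x = d * s ^ 2 := by
  have h6 : Squarefree (6 : ℤ) := by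
    rw [← Int.squarefree_natAbs]
    decide +kernel
  have hd0 : d ≠ 0 := by rintro rfl; norm_num at hd
  obtain ⟨s, rfl⟩ := (h6.squarefree_of_dvd hd).isRadical 2 k (Dvd.intro _ h)
  exact ⟨s, mul_left_cancel₀ hd0 (by linear_combination h)⟩

theorem exists_two_descent {a b y : ℤ} (hb : 0 < b) (hab : IsCoprime a b) (hy : y ≠ 0)
    (h : a * (a - 2 * b) * (a + b) = y ^ 2) : ∃ d e r s t : ℤ, (d = 1 ∨ d = -1 ∨ d = 2 ∨ d = -2) ∧
      (e = 1 ∨ e = 3) ∧ 0 < r ∧ 0 < s ∧ 0 < t ∧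
      a = d * r ^ 2 ∧ a - 2 * b = d * e * s ^ 2 ∧ a + b = e * t ^ 2 := by
  have hy2 : 0 < y ^ 2 := by positivity
  have hpos : 0 < a + b := by
    by_contra! h0
    have : 0 < a * (a - 2 * b) := mul_pos_of_neg_of_neg (by linarith) (by linarith)
    nlinarith
  obtain ⟨u, v, huv⟩ := hab
  obtain ⟨r, hr⟩ := eq_sq_or_of_mul_eq_sq (x := a) (w := (a - 2 * b) * (a + b)) (y := y)
    (g := 2 * u ^ 2 * a + 4 * u * v * b + v ^ 2 * (a - b)) (h := -v ^ 2) Int.prime_two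
    (by rw [← h]; ring) (by linear_combination (2 * (u * a + v * b) + 2) * huv)
  obtain ⟨t, ht⟩ := eq_sq_or_of_mul_eq_sq (x := a + b) (w := a * (a - 2 * b)) (y := y)
    (g := 3 * u ^ 2 * (a + b) + 6 * u * (v - u) * b - (v - u) ^ 2 * (a - 3 * b))
    (h := (v - u) ^ 2) Int.prime_three
    (by rw [← h]; ring) (by linear_combination (3 * (u * a + v * b) + 3) * huv)
  obtain ⟨d, hd, had⟩ : ∃ d : ℤ, (d = 1 ∨ d = -1 ∨ d = 2 ∨ d = -2) ∧ a = d * r ^ 2 := by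
    rcases hr with hr | hr | hr | hr
    · exact ⟨1, by simp, by linarith⟩
    · exact ⟨-1, by simp, by linarith⟩
    · exact ⟨2, by simp, by linarith⟩
    · exact ⟨-2, by simp, by linarith⟩
  obtain ⟨e, he, hae⟩ : ∃ e : ℤ, (e = 1 ∨ e = 3) ∧ a + b = e * t ^ 2 := by
    rcases ht with ht | ht | ht | ht
    · exact ⟨1, by simp, by linarith⟩
    · nlinarith [sq_nonneg t]
    · exact ⟨3, by simp, by linarith⟩
    · nlinarith [sq_nonneg t]
  have hr0 : r ≠ 0 := by rintro rfl; rw [← h, had] at hy2; simp at hy2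
  have ht0 : t ≠ 0 := by rintro rfl; rw [← h, hae] at hy2; simp at hy2
  have h' : (r * t) ^ 2 * (d * e * (a - 2 * b)) = y ^ 2 := by
    rw [← h, hae]; nth_rewrite 2 [had]; ring
  obtain ⟨k, rfl⟩ : r * t ∣ y := by
    rw [← Int.pow_dvd_pow_iff (n := 2) two_ne_zero, ← h']
    exact dvd_mul_right _ _
  have hk : d * e * (a - 2 * b) = k ^ 2 :=
    mul_left_cancel₀ (pow_ne_zero 2 (mul_ne_zero hr0 ht0)) (by rw [h']; ring)
  obtain ⟨s, hs⟩ := exists_eq_mul_sq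
    (by rcases hd with rfl | rfl | rfl | rfl <;> rcases he with rfl | rfl <;> norm_num) hk
  have hs0 : s ≠ 0 := by rintro rfl; rw [← h, hs] at hy2; simp at hy2
  refine ⟨d, e, |r|, |s|, |t|, hd, he, by positivity, by positivity, by positivity, ?_, ?_, ?_⟩ <;>
    rwa [sq_abs]

theorem exists_sq_denominator {a b y : ℤ}
    (h : 241 * a * b * (a - 2 * b) * (a + b) = y ^ 2) (hy : y ≠ 0) (hab : IsCoprime a b)
    (hdvd : 241 ∣ b) : ∃ a z y' : ℤ, 0 < z ∧ IsCoprime a (241 * z ^ 2) ∧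
      |y| = 241 * (z * |y'|) ∧ y' ≠ 0 ∧
      a * (a - 2 * (241 * z ^ 2)) * (a + 241 * z ^ 2) = y' ^ 2 := by
  obtain ⟨a, z, y', hz, hab, hyz, h2⟩ : ∃ a z y' : ℤ, 0 < z ∧ IsCoprime a (241 * z ^ 2) ∧
      |y| = 241 * (z * |y'|) ∧ a * (a - 2 * (241 * z ^ 2)) * (a + 241 * z ^ 2) = y' ^ 2 := by
    obtain ⟨b, rfl⟩ := hdvd
    obtain ⟨y, rfl⟩ : (241 : ℤ) ∣ y :=
      prime_241.dvd_of_dvd_pow (n := 2) (Dvd.intro _ (by rw [← h, mul_assoc, mul_assoc, mul_assoc]))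
    have h1 : b * (a * (a - 2 * (241 * b)) * (a + 241 * b)) = y ^ 2 := by linarith
    have hc : IsCoprime b (a * (a - 2 * (241 * b)) * (a + 241 * b)) := by
      have h0 : IsCoprime b a := hab.of_mul_right_right.symm
      refine (h0.mul_right ?_).mul_right ?_
      · rw [show a - 2 * (241 * b) = a + b * (-482) by ring]; exact h0.add_mul_left_right _
      · rw [mul_comm (241 : ℤ) b]; exact h0.add_mul_left_right _
    have hyz : ∀ z w : ℤ, |241 * (z * w)| = 241 * (|z| * |w|) := fun z w => by
      rw [abs_mul, abs_mul, abs_of_pos (show (0 : ℤ) < 241 by norm_num)]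
    obtain ⟨z, hz⟩ := Int.sq_of_isCoprime hc h1
    have hz0 : z ≠ 0 := by
      rintro rfl
      obtain rfl : b = 0 := by simpa using hz
      exact hy (by simpa using h1.symm)
    obtain ⟨y', rfl⟩ : z ∣ y := by
      rw [← Int.pow_dvd_pow_iff (n := 2) two_ne_zero, ← h1]
      rcases hz with rfl | rfl
      · exact dvd_mul_right _ _
      · exact ((dvd_refl _).neg_right).mul_right _
    rcases hz with rfl | rfl
    · refine ⟨a, |z|, y', by positivity, by rwa [sq_abs], hyz _ _, ?_⟩
      rw [sq_abs]
      exact mul_left_cancel₀ (pow_ne_zero 2 hz0) (by linear_combination h1)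
    · refine ⟨-a, |z|, y', by positivity, ?_, hyz _ _, ?_⟩
      · rw [sq_abs, IsCoprime.neg_left_iff]; simpa using hab.neg_right
      · rw [sq_abs]
        exact mul_left_cancel₀ (pow_ne_zero 2 hz0) (by linear_combination h1)
  refine ⟨a, z, y', hz, hab, hyz, ?_, h2⟩
  rintro rfl
  exact hy (by simpa using hyz)

theorem no_points_neg_one_neg_one_one {r s t z : ℤ} (hrz : r % 2 = 0 → z % 2 = 1)
    (h1 : r ^ 2 + 482 * z ^ 2 = s ^ 2) (h2 : 241 * z ^ 2 - r ^ 2 = t ^ 2) : False := by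
  have hr := sq_emod_eight r
  rcases sq_emod_eight z with hz | hz | hz
  · have hs := sq_emod_eight s
    omega
  · have ht := sq_emod_eight t
    omega
  · have ht := sq_emod_eight t
    omega

theorem no_points_two_two_one {r s t z : ℤ} (hz : z % 2 = 1)
    (h1 : r ^ 2 - 241 * z ^ 2 = s ^ 2) (h2 : 2 * r ^ 2 + 241 * z ^ 2 = t ^ 2) : False := by
  have hz8 : z ^ 2 % 8 = 1 := by
    have := sq_emod_eight z
    omega
  have hr : r ^ 2 % 4 = 0 := by
    have := sq_emod_eight r
    have := sq_emod_eight t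
    omega
  have hs := sq_emod_eight s
  omega

/-- The local conditions at `2` and `3`, and the second descent, leave only the trivial class. -/
theorem exists_trivial_class {a y z : ℤ} (hz : 0 < z) (hy : y ≠ 0)
    (hab : IsCoprime a (241 * z ^ 2))
    (h2 : a * (a - 2 * (241 * z ^ 2)) * (a + 241 * z ^ 2) = y ^ 2) :
    ∃ r s t : ℤ, 0 < r ∧ 0 < s ∧ 0 < t ∧ a = r ^ 2 ∧ a - 2 * (241 * z ^ 2) = s ^ 2 ∧
      a + 241 * z ^ 2 = t ^ 2 := by
  obtain ⟨d, e, r, s, t, hd, he, hr, hs, ht, har, has, hat⟩ :=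
    exists_two_descent (by positivity) hab hy h2
  have h2a : a % 2 = 0 → z % 2 = 1 := fun h3 => by
    by_contra h4
    have h5 : (2 : ℤ) ∣ 241 * z ^ 2 :=
      ((show (2 : ℤ) ∣ z by omega).pow two_ne_zero).mul_left 241
    have := hab.isUnit_of_dvd' (Int.dvd_of_emod_eq_zero h3) h5
    norm_num [Int.isUnit_iff] at this
  have h3a : ¬ (a % 3 = 0 ∧ z % 3 = 0) := by
    rintro ⟨h3, h4⟩
    have h5 : (3 : ℤ) ∣ 241 * z ^ 2 :=
      ((Int.dvd_of_emod_eq_zero h4).pow two_ne_zero).mul_left 241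
    have := hab.isUnit_of_dvd' (Int.dvd_of_emod_eq_zero h3) h5
    norm_num [Int.isUnit_iff] at this
  have hrz : IsCoprime r (241 * z ^ 2) :=
    hab.of_isCoprime_of_dvd_left ⟨d * r, by rw [har]; ring⟩
  clear h2
  rcases hd with rfl | rfl | rfl | rfl <;> rcases he with rfl | rfl
  · exact ⟨r, s, t, hr, hs, ht, by linarith, by linarith, by linarith⟩
  · clear h2a
    rcases sq_emod_three r with h3 | h3 <;> rcases sq_emod_three z with h4 | h4 <;> omega
  · exact (no_points_neg_one_neg_one_one (r := r) (s := s) (t := t) (z := z)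
      (fun h3 => h2a (by have := sq_emod_eight r; omega)) (by linarith)
      (by linarith)).elim
  · exact (no_points_neg_one_neg_three_three (t := t) hr hs hrz (by linarith)
      (by linarith)).elim
  · exact (no_points_two_two_one (r := r) (s := s) (t := t) (h2a (by omega)) (by linarith)
      (by linarith)).elim
  · exact (no_points_two_six_three (s := s) (t := t) hr (h2a (by omega)) hrz (by linarith)
      (by linarith)).elim
  · exact (no_points_neg_two_neg_two_one (t := t) hs (h2a (by omega)) hrz (by linarith)
      (by linarith)).elim
  · clear h2a
    rcases sq_emod_three r with h3 | h3 <;> rcases sq_emod_three z with h4 | h4 <;> omega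

theorem exists_smaller_of_dvd {a b y : ℤ} (h : 241 * a * b * (a - 2 * b) * (a + b) = y ^ 2)
    (hy : y ≠ 0) (hab : IsCoprime a b) (hdvd : 241 ∣ b) : ∃ a' b' y' : ℤ,
      241 * a' * b' * (a' - 2 * b') * (a' + b') = y' ^ 2 ∧ y' ≠ 0 ∧ 6 * |y'| < |y| := by
  obtain ⟨a, z, y', hz, hab, hyz, hy', h2⟩ := exists_sq_denominator h hy hab hdvd
  obtain ⟨r, s, t, hr, hs, ht, rfl, has, hat⟩ := exists_trivial_class hz hy' hab h2
  obtain ⟨a', b', y'', hy1, hy2, hy3⟩ := exists_smaller hr hs ht hz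
    ((IsCoprime.pow_left_iff two_pos).1 hab) has hat
  refine ⟨a', b', y'', hy1, hy2, ?_⟩
  have hyr : |y'| = r * s * t := by
    rw [← abs_of_pos (show 0 < r * s * t by positivity), ← sq_eq_sq_iff_abs_eq_abs, ← h2, has,
      hat]
    ring
  have ht15 : 15 < t := by
    apply lt_of_pow_lt_pow_left₀ 2 ht.le
    nlinarith
  have hrst : 15 < r * s * t :=
    ht15.trans_le (le_mul_of_one_le_left ht.le (Int.add_one_le_iff.2 (mul_pos hr hs)))
  rw [hyz, hyr]
  have : z * 15 < z * (r * s * t) := mul_lt_mul_of_pos_left hrst hz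
  linarith

theorem eq_zero_of_mul_eq_sq (a b y : ℤ) (h : 241 * a * b * (a - 2 * b) * (a + b) = y ^ 2) :
    y = 0 := by
  induction hn : y.natAbs using Nat.strong_induction_on generalizing a b y with
  | _ n ih =>
    by_contra hy
    obtain ⟨-, a₁, b₁, y₁, -, -, hc₁, hy₁, hle₁, h₁⟩ := exists_coprime h hy
    obtain ⟨a₂, b₂, y₂, hna, hdb, hy₂, hle₂, h₂⟩ := exists_dvd_right h₁ hy₁ hc₁
    obtain ⟨g, a₃, b₃, y₃, rfl, rfl, hc₃, hy₃, hle₃, h₃⟩ := exists_coprime h₂ hy₂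
    have hd₃ : 241 ∣ b₃ := (prime_241.dvd_or_dvd hdb).resolve_left fun hg => hna (hg.mul_right _)
    obtain ⟨a₄, b₄, y₄, h₄, hy₄, hlt⟩ := exists_smaller_of_dvd h₃ hy₃ hc₃ hd₃
    simp only [Int.abs_eq_natAbs] at hle₁ hle₂ hle₃ hlt
    exact hy₄ (ih _ (by omega) _ _ _ h₄ rfl)

/-- Every rational point on the genus 1 curve `E₃ : −y² = (x + 241)(x − 241)(x − 482)` has
`y = 0`; i.e. the only rational points of `E₃` are its points of order at most 2. -/
theorem rational_points_E3 (x y : ℚ) (h : -y ^ 2 = (x + 241) * (x - 241) * (x - 482)) :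
    y = 0 := by
  have hd : (x.den : ℚ) ≠ 0 := by exact_mod_cast x.den_ne_zero
  have hx : x = x.num / x.den := (Rat.num_div_den x).symm
  set n : ℤ := x.num
  set d : ℤ := (x.den : ℤ) with hdd
  have hd' : ((d : ℤ) : ℚ) = (x.den : ℚ) := by rw [hdd]; norm_cast
  rw [← hd'] at hd hx
  set a : ℤ := 241 * d - n with ha
  set b : ℤ := 241 * d with hb
  have hY : ((241 * a * b * (a - 2 * b) * (a + b) : ℤ) : ℚ) = (241 * d ^ 2 * y) ^ 2 := by
    have h' : y ^ 2 = -((x + 241) * (x - 241) * (x - 482)) := by linarith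
    rw [mul_pow, h', ha, hb, hx]
    push_cast
    field_simp
    ring
  obtain ⟨Y, hY'⟩ := Rat.isSquare_intCast_iff.1 (hY ▸ IsSquare.sq _)
  have hY0 := eq_zero_of_mul_eq_sq a b Y (by rw [hY', sq])
  rw [hY', hY0] at hY
  have := pow_eq_zero_iff (two_ne_zero) |>.1 (hY.symm.trans (by simp))
  simpa [hd] using this
end
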